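/- For every n ∈ ℕ with n ≥ 1, every a ∈ ℂ, and every z ∈ ℂ, the superoscillation function F_n(a,z) = (cos(z/n) + i a sin(z/n))^n admits the expansion F_n(a,z) = Σ_{j=0}^n C_j(n,a) e^{iz(1 − 2j/n)}, where C_j(n,a) = binom(n,j) ((1+a)/2)^{n−j} ((1−a)/2)^j. Moreover, for every fixed z ∈ ℂ and fixed a ∈ ℂ, lim_{n→∞} F_n(a,z) = e^{iaz}. -/

import Mathlib

open Finset Filter

/-- The superoscillation kernel as a combination of two exponentials. -/
lemma cos_add_I_mul_sin_eq_exp (a w : ℂ) :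
    Complex.cos w + Complex.I * a * Complex.sin w
      = (1 - a) / 2 * Complex.exp (-w * Complex.I) + (1 + a) / 2 * Complex.exp (w * Complex.I) := by
  rw [Complex.cos, Complex.sin]
  linear_combination
    a * (Complex.exp (-w * Complex.I) - Complex.exp (w * Complex.I)) / 2 * Complex.I_sq

/-- If `f` has derivative `f'` at `0`, then `n (f (1/n) - f 0) → f'`. -/
lemma tendsto_natCast_mul_sub_of_hasDerivAt {f : ℂ → ℂ} {f' : ℂ} (hf : HasDerivAt f f' 0) :
    Tendsto (fun n : ℕ => (n : ℂ) * (f (n : ℂ)⁻¹ - f 0)) atTop (nhds f') := by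
  have hinv : Tendsto (fun n : ℕ => (n : ℂ)⁻¹) atTop (nhdsWithin 0 {0}ᶜ) := by
    refine tendsto_nhdsWithin_iff.2 ⟨tendsto_inv_atTop_nhds_zero_nat, ?_⟩
    filter_upwards [eventually_ne_atTop 0] with n hn
    simpa using hn
  refine (hf.tendsto_slope.comp hinv).congr fun n => ?_
  simp [slope_def_field, div_eq_mul_inv, mul_comm]

/-- **Kernel expansion and supershift property of the superoscillation sequence.** For every
`n ≥ 1` and `a, z ∈ ℂ`, the superoscillation function
`F_n(a,z) = (cos(z/n) + i a sin(z/n))^n` admits the expansion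
`F_n(a,z) = ∑_{j=0}^n C_j(n,a) e^{iz(1 − 2j/n)}` with
`C_j(n,a) = (n choose j) ((1+a)/2)^{n−j} ((1−a)/2)^j`; moreover for every fixed `a, z ∈ ℂ`,
`F_n(a,z) → e^{iaz}` as `n → ∞`. -/
theorem superoscillation_expansion_and_supershift :
    (∀ (n : ℕ), 1 ≤ n → ∀ a z : ℂ,
      (Complex.cos (z / n) + Complex.I * a * Complex.sin (z / n)) ^ n
        = ∑ j ∈ Finset.range (n + 1),
            (n.choose j : ℂ) * ((1 + a) / 2) ^ (n - j) * ((1 - a) / 2) ^ j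
              * Complex.exp (Complex.I * z * (1 - 2 * j / n)))
    ∧ ∀ a z : ℂ,
        Tendsto (fun n : ℕ => (Complex.cos (z / n) + Complex.I * a * Complex.sin (z / n)) ^ n)
          atTop (nhds (Complex.exp (Complex.I * a * z))) := by
  refine ⟨fun n hn a z => ?_, fun a z => ?_⟩
  · have hn0 : (n : ℂ) ≠ 0 := Nat.cast_ne_zero.2 (by omega)
    rw [cos_add_I_mul_sin_eq_exp, add_pow]
    refine Finset.sum_congr rfl fun j hj => ?_
    have hjn : j ≤ n := Nat.lt_succ_iff.1 (Finset.mem_range.1 hj)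
    have hexp : Complex.exp (Complex.I * z * (1 - 2 * j / n))
        = Complex.exp (-(z / n) * Complex.I) ^ j * Complex.exp (z / n * Complex.I) ^ (n - j) := by
      rw [← Complex.exp_nat_mul, ← Complex.exp_nat_mul, ← Complex.exp_add, Nat.cast_sub hjn]
      congr 1
      field_simp
      ring
    rw [hexp, mul_pow, mul_pow]
    ring
  · have hderiv : HasDerivAt
        (fun w : ℂ => Complex.cos (z * w) + Complex.I * a * Complex.sin (z * w))
        (Complex.I * a * z) 0 := by
      have hlin : HasDerivAt (fun w : ℂ => z * w) z 0 := by
        simpa using (hasDerivAt_id (0 : ℂ)).const_mul z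
      simpa [mul_assoc] using hlin.ccos.fun_add (hlin.csin.const_mul (Complex.I * a))
    refine (Complex.tendsto_one_add_pow_exp_of_tendsto
      (tendsto_natCast_mul_sub_of_hasDerivAt hderiv)).congr fun n => ?_
    simp [div_eq_mul_inv]
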